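/- Under Frobenius L_F-smoothness and the Frobenius diameter assumption, in the noiseless case (G_t = ∇f(Y_t), σ = 0), for any fixed β ∈ [0,1), choosing μ = 0 and η = √(2A_T/(L_F r T)) with A_T := Δ + 2L_F D_F²(log(eT) + π²/6), Schedule-Free Spectral Descent with momentum satisfies for every T ≥ 1: (1/T)·Σ_{t=0}^{T−1} ‖∇f(Y_t)‖_* ≤ (1/(1−β))·[√(2 L_F r A_T / T) + 2√r L_F D_F log(eT)/T]; in particular the left-hand side is O(√(log T / T)). -/

import Mathlib

open Matrix MeasureTheory Finset Filter

noncomputable section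

/-- Real `m × n` matrices. -/
abbrev Mat (m n : ℕ) := Matrix (Fin m) (Fin n) ℝ

/-- Frobenius (trace) inner product `⟨A, B⟩_F = tr(Aᵀ B)`. -/
def frobInner {m n : ℕ} (A B : Mat m n) : ℝ := ∑ i, ∑ j, A i j * B i j

/-- Frobenius norm. -/
def frobNorm {m n : ℕ} (A : Mat m n) : ℝ := Real.sqrt (∑ i, ∑ j, (A i j) ^ 2)

/-- Spectral norm (`ℓ₂ → ℓ₂` operator norm, i.e. largest singular value). -/
def specNorm {m n : ℕ} (A : Mat m n) : ℝ :=
  sSup {c : ℝ | ∃ u : Fin n → ℝ, (∑ j, (u j) ^ 2) ≤ 1 ∧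
    c = Real.sqrt (∑ i, (A.mulVec u i) ^ 2)}

/-- Nuclear norm (sum of singular values), via duality with the spectral norm. -/
def nucNorm {m n : ℕ} (A : Mat m n) : ℝ :=
  sSup {c : ℝ | ∃ Q : Mat m n, specNorm Q ≤ 1 ∧ c = frobInner A Q}

/-- `P` is the polar factor `U Vᵀ` of a compact SVD `M = U Σ Vᵀ`
(`U`, `V` with orthonormal columns, `Σ` positive diagonal). -/
def IsPolarFactor {m n : ℕ} (M P : Mat m n) : Prop :=
  ∃ (k : ℕ) (U : Matrix (Fin m) (Fin k) ℝ) (V : Matrix (Fin n) (Fin k) ℝ)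
    (s : Fin k → ℝ),
    Uᵀ * U = 1 ∧ Vᵀ * V = 1 ∧ (∀ i, 0 < s i) ∧
    M = U * Matrix.diagonal s * Vᵀ ∧ P = U * Vᵀ

/-- `gradf` is the gradient of `f` with respect to the Frobenius inner product:
along every line `s ↦ A + s • H`, `f` has derivative `⟨gradf A, H⟩_F` at `s = 0`. -/
def IsGradient {m n : ℕ} (f : Mat m n → ℝ) (gradf : Mat m n → Mat m n) : Prop :=
  ∀ A H : Mat m n, HasDerivAt (fun s : ℝ => f (A + s • H)) (frobInner (gradf A) H) 0

section FrobeniusGeometry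

variable {m n : ℕ}

attribute [local instance] Matrix.frobeniusNormedAddCommGroup Matrix.frobeniusNormedSpace

theorem frobNorm_eq_norm (A : Mat m n) : frobNorm A = ‖A‖ := by
  simp [frobNorm, Matrix.frobenius_norm_def, Real.sqrt_eq_rpow]

theorem frobNorm_nonneg (A : Mat m n) : 0 ≤ frobNorm A := Real.sqrt_nonneg _

theorem frobNorm_add_le (A B : Mat m n) : frobNorm (A + B) ≤ frobNorm A + frobNorm B := by
  simpa only [frobNorm_eq_norm] using norm_add_le A B

theorem frobNorm_sub_le (A B : Mat m n) : frobNorm (A - B) ≤ frobNorm A + frobNorm B := by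
  simpa only [frobNorm_eq_norm] using norm_sub_le A B

theorem frobNorm_smul (c : ℝ) (A : Mat m n) : frobNorm (c • A) = |c| * frobNorm A := by
  simpa only [frobNorm_eq_norm, Real.norm_eq_abs] using norm_smul c A

theorem frobNorm_combo_le {a b R : ℝ} {A B : Mat m n} (ha : 0 ≤ a) (hb : 0 ≤ b)
    (hab : a + b = 1) (hA : frobNorm A ≤ R) (hB : frobNorm B ≤ R) :
    frobNorm (a • A + b • B) ≤ R := by
  refine (frobNorm_add_le _ _).trans ?_
  rw [frobNorm_smul, frobNorm_smul, abs_of_nonneg ha, abs_of_nonneg hb]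
  calc a * frobNorm A + b * frobNorm B ≤ a * R + b * R := by gcongr
    _ = R := by rw [← add_mul, hab, one_mul]

end FrobeniusGeometry

section FrobeniusInner

variable {m n : ℕ}

theorem frobInner_eq_trace (A B : Mat m n) : frobInner A B = (Aᵀ * B).trace := by
  simp only [frobInner, Matrix.trace, Matrix.diag_apply, Matrix.mul_apply, Matrix.transpose_apply]
  exact Finset.sum_comm

theorem frobInner_add_right (A B C : Mat m n) :
    frobInner A (B + C) = frobInner A B + frobInner A C := by
  simp [frobInner_eq_trace, Matrix.mul_add]

theorem frobInner_sub_left (A B C : Mat m n) :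
    frobInner (A - B) C = frobInner A C - frobInner B C := by
  simp [frobInner_eq_trace, Matrix.sub_mul]

theorem frobInner_smul_right (c : ℝ) (A B : Mat m n) :
    frobInner A (c • B) = c * frobInner A B := by
  simp [frobInner_eq_trace]

theorem frobInner_le (A B : Mat m n) : frobInner A B ≤ frobNorm A * frobNorm B := by
  simp only [frobInner, frobNorm, ← Finset.sum_product']
  exact Real.sum_mul_le_sqrt_mul_sqrt _ _ _

theorem frobNorm_sq (A : Mat m n) : frobNorm A ^ 2 = frobInner A A := by
  rw [frobNorm, Real.sq_sqrt (by positivity)]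
  simp [frobInner, sq]

end FrobeniusInner

section SpectralNuclear

variable {m n : ℕ}

theorem sqrt_sum_mulVec_sq_le (Q : Mat m n) (u : Fin n → ℝ) (hu : ∑ j, u j ^ 2 ≤ 1) :
    √(∑ i, (Q.mulVec u i) ^ 2) ≤ frobNorm Q := by
  refine Real.sqrt_le_sqrt (Finset.sum_le_sum fun i _ => ?_)
  refine (Finset.sum_mul_sq_le_sq_mul_sq Finset.univ (Q i) u).trans ?_
  exact mul_le_of_le_one_right (by positivity) hu

theorem sqrt_sum_mulVec_sq_le_specNorm (Q : Mat m n) (u : Fin n → ℝ) (hu : ∑ j, u j ^ 2 ≤ 1) :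
    √(∑ i, (Q.mulVec u i) ^ 2) ≤ specNorm Q := by
  refine le_csSup ⟨frobNorm Q, ?_⟩ ⟨u, hu, rfl⟩
  rintro c ⟨v, hv, rfl⟩
  exact sqrt_sum_mulVec_sq_le Q v hv

theorem dotProduct_mulVec_le_one {Q : Mat m n} (hQ : specNorm Q ≤ 1) {u : Fin m → ℝ}
    {v : Fin n → ℝ} (hu : ∑ i, u i ^ 2 ≤ 1) (hv : ∑ j, v j ^ 2 ≤ 1) :
    u ⬝ᵥ Q.mulVec v ≤ 1 := by
  refine (Real.sum_mul_le_sqrt_mul_sqrt _ _ _).trans ?_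
  exact mul_le_one₀ (Real.sqrt_le_one.mpr hu) (Real.sqrt_nonneg _)
    ((sqrt_sum_mulVec_sq_le_specNorm Q v hv).trans hQ)

theorem frobInner_svd {k : ℕ} (U : Matrix (Fin m) (Fin k) ℝ) (V : Matrix (Fin n) (Fin k) ℝ)
    (s : Fin k → ℝ) (Q : Mat m n) :
    frobInner (U * Matrix.diagonal s * Vᵀ) Q = ∑ i, s i * (Uᵀ * Q * V) i i := by
  have : ((U * Matrix.diagonal s * Vᵀ)ᵀ * Q).trace
      = (Matrix.diagonal s * (Uᵀ * Q * V)).trace := by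
    simp only [Matrix.transpose_mul, Matrix.transpose_transpose, Matrix.diagonal_transpose]
    rw [Matrix.mul_assoc, Matrix.trace_mul_comm]
    simp only [Matrix.mul_assoc]
  rw [frobInner_eq_trace, this]
  simp [Matrix.trace, Matrix.diagonal_mul]

theorem sum_col_sq_eq_one {k : ℕ} {U : Matrix (Fin m) (Fin k) ℝ} (hU : Uᵀ * U = 1)
    (i : Fin k) : ∑ a, Uᵀ i a ^ 2 = 1 := by
  have := congrFun (congrFun hU i) i
  simpa [Matrix.mul_apply, sq] using this

/-- The polar factor attains the supremum defining the nuclear norm. -/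
theorem IsPolarFactor.nucNorm_le {M P : Mat m n} (h : IsPolarFactor M P) :
    nucNorm M ≤ frobInner M P := by
  obtain ⟨k, U, V, s, hU, hV, hs, rfl, rfl⟩ := h
  have hP : frobInner (U * Matrix.diagonal s * Vᵀ) (U * Vᵀ) = ∑ i, s i := by
    rw [frobInner_svd, ← Matrix.mul_assoc, hU, Matrix.one_mul, hV]
    simp
  rw [hP]
  refine Real.sSup_le ?_ (Finset.sum_nonneg fun i _ => (hs i).le)
  rintro c ⟨Q, hQ, rfl⟩
  rw [frobInner_svd]
  refine Finset.sum_le_sum fun i _ => mul_le_of_le_one_right (hs i).le ?_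
  have h := dotProduct_mulVec_le_one hQ (sum_col_sq_eq_one hU i).le (sum_col_sq_eq_one hV i).le
  rw [Matrix.mul_assoc]
  exact h

theorem card_le_of_transpose_mul_self_eq_one {k : ℕ} {U : Matrix (Fin m) (Fin k) ℝ}
    (hU : Uᵀ * U = 1) : k ≤ m := by
  have h := Matrix.rank_mul_le_right Uᵀ U
  rw [hU, Matrix.rank_one, Fintype.card_fin] at h
  exact h.trans U.rank_le_height

theorem IsPolarFactor.frobNorm_sq_le {M P : Mat m n} (h : IsPolarFactor M P) :
    frobNorm P ^ 2 ≤ ((min m n : ℕ) : ℝ) := by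
  obtain ⟨k, U, V, s, hU, hV, -, -, rfl⟩ := h
  have hk : frobNorm (U * Vᵀ) ^ 2 = k := by
    have := frobInner_svd U V (fun _ => 1) (U * Vᵀ)
    rw [← Matrix.mul_assoc, hU, Matrix.one_mul, hV] at this
    rw [frobNorm_sq]
    simpa using this
  rw [hk]
  exact_mod_cast le_min (card_le_of_transpose_mul_self_eq_one hU)
    (card_le_of_transpose_mul_self_eq_one hV)

end SpectralNuclear

section Smoothness

variable {m n : ℕ} {f : Mat m n → ℝ} {gradf : Mat m n → Mat m n} {L : ℝ}

theorem IsGradient.hasDerivAt (hgrad : IsGradient f gradf) (A H : Mat m n) (s : ℝ) :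
    HasDerivAt (fun s : ℝ => f (A + s • H)) (frobInner (gradf (A + s • H)) H) s := by
  have h := hgrad (A + s • H) H
  rw [← sub_self s] at h
  refine (h.comp_sub_const s s).congr_of_eventuallyEq (.of_forall fun x => ?_)
  simp [add_assoc, ← add_smul]

/-- Quadratic upper bound for functions with Lipschitz gradient. -/
theorem IsGradient.le_quadratic (hgrad : IsGradient f gradf)
    (hsmooth : ∀ A B : Mat m n, frobNorm (gradf A - gradf B) ≤ L * frobNorm (A - B))
    (A H : Mat m n) :
    f (A + H) ≤ f A + frobInner (gradf A) H + L / 2 * frobNorm H ^ 2 := by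
  let φ : ℝ → ℝ := fun s =>
    f (A + s • H) - s * frobInner (gradf A) H - L / 2 * frobNorm H ^ 2 * s ^ 2
  have hφ (s : ℝ) : HasDerivAt φ (frobInner (gradf (A + s • H)) H - frobInner (gradf A) H
      - L * frobNorm H ^ 2 * s) s := by
    refine (((hgrad.hasDerivAt A H s).sub ((hasDerivAt_id s).mul_const _)).sub
      ((hasDerivAt_pow 2 s).const_mul (L / 2 * frobNorm H ^ 2))).congr_deriv ?_
    norm_num
    ring
  have hanti : AntitoneOn φ (Set.Ici 0) := by
    refine antitoneOn_of_deriv_nonpos (convex_Ici 0)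
      (fun s _ => (hφ s).continuousAt.continuousWithinAt)
      (fun s _ => (hφ s).differentiableAt.differentiableWithinAt) fun s hs => ?_
    rw [interior_Ici] at hs
    have hs0 : 0 < s := hs
    rw [(hφ s).deriv, ← frobInner_sub_left]
    have h1 := frobInner_le (gradf (A + s • H) - gradf A) H
    have h2 := hsmooth (A + s • H) A
    rw [add_sub_cancel_left, frobNorm_smul, abs_of_pos hs0] at h2
    have h3 := mul_le_mul_of_nonneg_right h2 (frobNorm_nonneg H)
    linarith
  have h := hanti (Set.mem_Ici.mpr le_rfl) (Set.mem_Ici.mpr zero_le_one) zero_le_one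
  simp only [φ, one_smul, zero_smul, add_zero] at h
  linarith

end Smoothness

theorem sum_range_one_div_add_one_le_log {T : ℕ} (hT : 1 ≤ T) :
    ∑ t ∈ Finset.range T, 1 / ((t : ℝ) + 1) ≤ Real.log (Real.exp 1 * T) := by
  have hT0 : (T : ℝ) ≠ 0 := by positivity
  rw [Real.log_mul (Real.exp_ne_zero 1) hT0, Real.log_exp]
  simpa [harmonic] using harmonic_le_one_add_log T

/-- One step of the descent along `β • U - ((1 - β) * η) • P`, where `U` is the drift of the
running average and `P` the polar factor of the gradient. -/
theorem descent_step {m n : ℕ} {f : Mat m n → ℝ} {gradf : Mat m n → Mat m n}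
    (hgrad : IsGradient f gradf) {β L D η c : ℝ} (hβ0 : 0 ≤ β) (hβ1 : β ≤ 1) (hL : 0 ≤ L)
    (hη : 0 ≤ η) (hc : 0 ≤ c) (hc1 : c ≤ 1)
    (hsmooth : ∀ A B : Mat m n, frobNorm (gradf A - gradf B) ≤ L * frobNorm (A - B))
    {A U P : Mat m n} (hP : IsPolarFactor (gradf A) P) (hG : frobNorm (gradf A) ≤ L * D)
    (hU : frobNorm U ≤ D) :
    (1 - β) * η * nucNorm (gradf A) ≤
      f A - f (A + (β • (c • U) + (1 - β) • ((-η) • P))) + 3 / 2 * (L * D ^ 2) * c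
        + L / 2 * (η ^ 2 * ((min m n : ℕ) : ℝ)) := by
  have hβ' : 0 ≤ 1 - β := sub_nonneg.mpr hβ1
  have hD : 0 ≤ D := (frobNorm_nonneg U).trans hU
  set r : ℝ := ((min m n : ℕ) : ℝ)
  have hquad := hgrad.le_quadratic hsmooth A (β • (c • U) + (1 - β) • ((-η) • P))
  have hinner : frobInner (gradf A) U ≤ L * D ^ 2 := by
    refine (frobInner_le _ _).trans ?_
    calc frobNorm (gradf A) * frobNorm U ≤ L * D * D :=
          mul_le_mul hG hU (frobNorm_nonneg _) (by positivity)
      _ = L * D ^ 2 := by ring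
  have hnorm : frobNorm (β • (c • U) + (1 - β) • ((-η) • P)) ≤
      β * (c * D) + (1 - β) * (η * frobNorm P) := by
    refine (frobNorm_add_le _ _).trans ?_
    simp only [frobNorm_smul, abs_neg, abs_of_nonneg hβ0, abs_of_nonneg hβ', abs_of_nonneg hc,
      abs_of_nonneg hη]
    gcongr
  have hsq : frobNorm (β • (c • U) + (1 - β) • ((-η) • P)) ^ 2 ≤ c * D ^ 2 + η ^ 2 * r := by
    have hp := frobNorm_nonneg P
    have h1 := pow_le_pow_left₀ (frobNorm_nonneg _) hnorm 2
    have hconv : (β * (c * D) + (1 - β) * (η * frobNorm P)) ^ 2 ≤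
        β * (c * D) ^ 2 + (1 - β) * (η * frobNorm P) ^ 2 := by
      have := mul_nonneg (mul_nonneg hβ0 hβ') (sq_nonneg (c * D - η * frobNorm P))
      linarith
    have h2 : β * (c * D) ^ 2 ≤ c * D ^ 2 := by
      calc β * (c * D) ^ 2 ≤ 1 * (c * D) ^ 2 := by gcongr
        _ = c * (c * D ^ 2) := by ring
        _ ≤ c * D ^ 2 := by gcongr; exact mul_le_of_le_one_left (by positivity) hc1
    have h3 : (1 - β) * (η * frobNorm P) ^ 2 ≤ η ^ 2 * r := by
      calc (1 - β) * (η * frobNorm P) ^ 2 ≤ 1 * (η * frobNorm P) ^ 2 := by gcongr; linarith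
        _ = η ^ 2 * frobNorm P ^ 2 := by ring
        _ ≤ η ^ 2 * r := by gcongr; exact hP.frobNorm_sq_le
    linarith
  simp only [frobInner_add_right, frobInner_smul_right] at hquad
  have h1 := mul_le_mul_of_nonneg_left hP.nucNorm_le (mul_nonneg hβ' hη)
  have h2 : β * (c * frobInner (gradf A) U) ≤ L * D ^ 2 * c := by
    calc β * (c * frobInner (gradf A) U) ≤ β * (c * (L * D ^ 2)) := by gcongr
      _ ≤ 1 * (c * (L * D ^ 2)) := by gcongr
      _ = L * D ^ 2 * c := by ring
  have h3 := mul_le_mul_of_nonneg_left hsq (div_nonneg hL zero_le_two)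
  linarith

/-- **Noiseless tuned rate under Frobenius smoothness.** With `μ = 0` and
`η = √(2A_T/(L_F r T))`, `A_T = Δ + 2L_F D_F²(log(eT) + π²/6)`, `r = min{m,n}`,
for every `T ≥ 1`: `(1/T)·Σ_{t<T} ‖∇f(Y_t)‖_* ≤
(1/(1−β))·[√(2L_F r A_T/T) + 2√r L_F D_F log(eT)/T]`. -/
theorem sf_frobenius_noiseless_tuned_rate {m n : ℕ}
    (f : Mat m n → ℝ) (gradf : Mat m n → Mat m n) (hgrad : IsGradient f gradf)
    (β LF DF : ℝ) (hβ0 : 0 ≤ β) (hβ1 : β < 1) (hLF : 0 < LF)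
    (hsmooth : ∀ A B : Mat m n, frobNorm (gradf A - gradf B) ≤ LF * frobNorm (A - B))
    (Wstar : Mat m n) (hWgrad : gradf Wstar = 0) (hWdiam : frobNorm Wstar ≤ DF / 2) :
    ∀ T : ℕ, 1 ≤ T →
    ∀ Y Z X P : ℕ → Mat m n,
      (∀ t, Y t = β • X t + (1 - β) • Z t) →
      (∀ t, IsPolarFactor (gradf (Y t)) (P t)) →
      (∀ t, Z (t + 1) = Z t -
        Real.sqrt (2 * (f (Y 0) - f Wstar +
            2 * LF * DF ^ 2 * (Real.log (Real.exp 1 * T) + Real.pi ^ 2 / 6)) /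
          (LF * ((min m n : ℕ) : ℝ) * T)) • P t) →
      X 0 = Z 0 →
      (∀ t : ℕ, X (t + 1) =
        ((t : ℝ) / ((t : ℝ) + 1)) • X t + (1 / ((t : ℝ) + 1)) • Z (t + 1)) →
      (∀ t, frobNorm (Z t) ≤ DF / 2) →
      (1 / (T : ℝ)) * ∑ t ∈ Finset.range T, nucNorm (gradf (Y t)) ≤
        (1 / (1 - β)) *
          (Real.sqrt (2 * LF * ((min m n : ℕ) : ℝ) * (f (Y 0) - f Wstar +
              2 * LF * DF ^ 2 * (Real.log (Real.exp 1 * T) + Real.pi ^ 2 / 6)) / T)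
            + 2 * Real.sqrt ((min m n : ℕ) : ℝ) * LF * DF *
                Real.log (Real.exp 1 * T) / T) := by
  intro T hT Y Z X P hY hP hZ hX0 hX hZD
  have hDF : 0 ≤ DF := by linarith [frobNorm_nonneg Wstar]
  have hβ' : 0 < 1 - β := sub_pos.mpr hβ1
  have hT0 : (0 : ℝ) < T := by exact_mod_cast hT
  have hXD (t : ℕ) : frobNorm (X t) ≤ DF / 2 := by
    induction t with
    | zero => rw [hX0]; exact hZD 0
    | succ t ih =>
      rw [hX t]
      exact frobNorm_combo_le (by positivity) (by positivity) (by field_simp) ih (hZD _)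
  have hYD (t : ℕ) : frobNorm (Y t) ≤ DF / 2 := by
    rw [hY t]
    exact frobNorm_combo_le hβ0 hβ'.le (by ring) (hXD t) (hZD t)
  have hdist (t : ℕ) : frobNorm (Y t - Wstar) ≤ DF :=
    (frobNorm_sub_le _ _).trans (by linarith [hYD t])
  have hG (t : ℕ) : frobNorm (gradf (Y t)) ≤ LF * DF := by
    have h := hsmooth (Y t) Wstar
    rw [hWgrad, sub_zero] at h
    exact h.trans (by gcongr; exact hdist t)
  have hlower (t : ℕ) : f Wstar ≤ f (Y t) + 3 / 2 * (LF * DF ^ 2) := by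
    have h := hgrad.le_quadratic hsmooth (Y t) (Wstar - Y t)
    rw [add_sub_cancel] at h
    have hd : frobNorm (Wstar - Y t) ≤ DF :=
      (frobNorm_sub_le _ _).trans (by linarith [hYD t])
    have h1 : frobInner (gradf (Y t)) (Wstar - Y t) ≤ LF * DF * DF :=
      (frobInner_le _ _).trans (mul_le_mul (hG t) hd (frobNorm_nonneg _) (by positivity))
    have h2 : LF / 2 * frobNorm (Wstar - Y t) ^ 2 ≤ LF / 2 * DF ^ 2 := by
      have := frobNorm_nonneg (Wstar - Y t)
      gcongr
    linarith
  set ℓ := Real.log (Real.exp 1 * T)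
  have hℓ : 1 ≤ ℓ := by
    rw [Real.le_log_iff_exp_le (by positivity)]
    exact le_mul_of_one_le_right (Real.exp_pos 1).le (by exact_mod_cast hT)
  have hπ : 3 / 2 ≤ Real.pi ^ 2 / 6 := by nlinarith [Real.pi_gt_three]
  set A := f (Y 0) - f Wstar + 2 * LF * DF ^ 2 * (ℓ + Real.pi ^ 2 / 6) with hA_def
  set r : ℝ := ((min m n : ℕ) : ℝ)
  have hr : 0 ≤ r := Nat.cast_nonneg _
  set η := √(2 * A / (LF * r * T))
  set S := ∑ t ∈ Finset.range T, nucNorm (gradf (Y t))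
  have hLD : 0 ≤ LF * DF ^ 2 := by positivity
  have hA : LF * DF ^ 2 ≤ A := by
    have h1 := mul_le_mul_of_nonneg_left (add_le_add hℓ hπ) hLD
    linarith [hlower 0, hA_def]
  have hA0 : 0 ≤ A := hLD.trans hA
  have hstep (t : ℕ) : Y (t + 1) = Y t +
      (β • ((1 / ((t : ℝ) + 1)) • (Z (t + 1) - X t)) + (1 - β) • ((-η) • P t)) := by
    have hc : (t : ℝ) / (t + 1) = 1 - 1 / (t + 1) := by field_simp; ring
    rw [hY (t + 1), hY t, hX t, hc, hZ t]
    module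
  have hdescent : (1 - β) * η * S ≤
      f (Y 0) - f (Y T) + 3 / 2 * (LF * DF ^ 2) * ℓ + T * (LF / 2 * (η ^ 2 * r)) := by
    have hsum : ∑ t ∈ Finset.range T, (1 - β) * η * nucNorm (gradf (Y t)) ≤
        ∑ t ∈ Finset.range T, (f (Y t) - f (Y (t + 1))
          + 3 / 2 * (LF * DF ^ 2) * (1 / ((t : ℝ) + 1)) + LF / 2 * (η ^ 2 * r)) := by
      refine Finset.sum_le_sum fun t _ => ?_
      rw [hstep t]
      refine descent_step hgrad hβ0 hβ1.le hLF.le (Real.sqrt_nonneg _) (by positivity) ?_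
        hsmooth (hP t) (hG t) ?_
      · rw [div_le_one (by positivity)]
        linarith [t.cast_nonneg (α := ℝ)]
      · exact (frobNorm_sub_le _ _).trans (by linarith [hZD (t + 1), hXD t])
    rw [← Finset.mul_sum, Finset.sum_add_distrib, Finset.sum_add_distrib,
      Finset.sum_range_sub', ← Finset.mul_sum, Finset.sum_const, Finset.card_range,
      nsmul_eq_mul] at hsum
    have := mul_le_mul_of_nonneg_left (sum_range_one_div_add_one_le_log hT)
      (mul_nonneg (by norm_num : (0 : ℝ) ≤ 3 / 2) hLD)
    linarith
  have hrest : 0 ≤ 2 * √r * LF * DF * ℓ / T := by positivity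
  have hmain : (1 - β) * S ≤ √(2 * LF * r * A / T) * T := by
    by_cases hdeg : r = 0 ∨ DF = 0
    · have hN (t : ℕ) : nucNorm (gradf (Y t)) ≤ 0 := by
        refine (hP t).nucNorm_le.trans ((frobInner_le _ _).trans ?_)
        rcases hdeg with h | h
        · have hp := (hP t).frobNorm_sq_le
          have : frobNorm (P t) = 0 :=
            pow_eq_zero_iff two_ne_zero |>.mp (le_antisymm (hp.trans h.le) (sq_nonneg _))
          rw [this, mul_zero]
        · have := hG t
          rw [h, mul_zero] at this
          exact mul_nonpos_of_nonpos_of_nonneg this (frobNorm_nonneg _)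
      have hS : S ≤ 0 := Finset.sum_nonpos fun t _ => hN t
      exact (mul_nonpos_of_nonneg_of_nonpos hβ'.le hS).trans (by positivity)
    · rw [not_or] at hdeg
      have hr0 : 0 < r := lt_of_le_of_ne hr (Ne.symm hdeg.1)
      have hD0 : 0 < DF := lt_of_le_of_ne hDF (Ne.symm hdeg.2)
      have hApos : 0 < A := lt_of_lt_of_le (by positivity) hA
      have hη : 0 < η := Real.sqrt_pos.mpr (by positivity)
      have hη2 : T * (LF / 2 * (η ^ 2 * r)) = A := by
        rw [Real.sq_sqrt (by positivity)]
        field_simp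
      have hprod : η * (√(2 * LF * r * A / T) * T) = 2 * A := by
        rw [← mul_assoc, ← Real.sqrt_mul (by positivity),
          show 2 * A / (LF * r * T) * (2 * LF * r * A / T) = (2 * A / T) ^ 2 by field_simp,
          Real.sqrt_sq (by positivity)]
        field_simp
      refine le_of_mul_le_mul_left ?_ hη
      rw [hprod]
      have h1 := mul_le_mul_of_nonneg_left hℓ hLD
      have h2 := mul_le_mul_of_nonneg_left hπ hLD
      linarith [hlower T, hA_def]
  rw [one_div_mul_eq_div, one_div_mul_eq_div, div_le_div_iff₀ hT0 hβ', add_mul]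
  have := mul_nonneg hrest hT0.le
  linarith
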